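/- arXiv:2501.14612 — 3 statements merged into one kernel-verified Lean document; each statement's English description precedes it below -/
import Mathlib

section
/- Let f be the Spohn cubic of a 2×2 game with real payoff matrices A = (a_{ij}), B = (b_{ij}), and assume f ≠ 0. Then f is reducible (i.e., f is a product of two non-constant polynomials in ℝ[x,y,z]) if and only if at least one of the following twelve conditions holds: (1) a11=a12; (2) a11=a21; (3) a21=a22; (4) b11=b12; (5) b11=b21; (6) b12=b22; (7) a12=a22 and b21=b22; (8) a12=a21 and b12=b21; (9) a12(b12−b22)+a21(b22−b21)+a22(b21−b12) = 0, a11(b22−b12)+a21(b11−b22)+a22(b12−b11) = 0, and a11(b22−b21)+a12(b11−b22)+a22(b21−b11) = 0; (10) a11(b12−b21)+a12(b21−b22)+a21(b22−b12) = 0, a12(b11−b21)+a21(b12−b11)+a22(b21−b12) = 0, and a11(b11−b21)+a21(b22−b11)+a22(b21−b22) = 0; (11) a12(b22−b21)+a21(b12−b22)+a22(b21−b12) = 0, a11(b22−b21)+a21(b11−b22)+a22(b21−b11) = 0, and a11(b22−b12)+a12(b11−b22)+a22(b12−b11) = 0; (12) a11(b12−b21)+a12(b22−b12)+a21(b21−b22)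 = 0, a12(b11−b12)+a21(b21−b11)+a22(b12−b21) = 0, and a11(b11−b21)+a12(b22−b12)+a21(b21−b11)+a22(b12−b22) = 0. -/
open MvPolynomial

/-- The Spohn cubic of the `2 × 2` game with payoff matrices `A = (aᵢⱼ)`, `B = (bᵢⱼ)`:
the ternary cubic `c1·x²y + c2·x²z + c3·xy² + c4·xz² + c5·y²z + c6·yz² + c7·xyz`
in `ℝ[x, y, z]` (with `x = X 0`, `y = X 1`, `z = X 2`). -/
noncomputable def spohnCubic (a11 a12 a21 a22 b11 b12 b21 b22 : ℝ) :
    MvPolynomial (Fin 3) ℝ :=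
  C ((a11 - a22) * (b11 - b12)) * X 0 ^ 2 * X 1
    + C ((a11 - a21) * (b22 - b11)) * X 0 ^ 2 * X 2
    + C ((a12 - a22) * (b11 - b12)) * X 0 * X 1 ^ 2
    + C ((a11 - a21) * (b22 - b21)) * X 0 * X 2 ^ 2
    + C ((a12 - a22) * (b21 - b12)) * X 1 ^ 2 * X 2
    + C ((a12 - a21) * (b22 - b21)) * X 1 * X 2 ^ 2
    + C ((a12 - a21) * (b22 - b11) + (a11 - a22) * (b21 - b12)) * X 0 * X 1 * X 2

namespace MvPolynomial

theorem homogeneousComponent_add_mul {σ R : Type*} [CommSemiring R]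
    {g h : MvPolynomial σ R} {m n : ℕ} (hg : g.totalDegree ≤ m) (hh : h.totalDegree ≤ n) :
    homogeneousComponent (m + n) (g * h) = homogeneousComponent m g * homogeneousComponent n h := by
  classical
  ext d
  by_cases hd : d.degree = m + n
  · rw [coeff_homogeneousComponent, if_pos hd, coeff_mul, coeff_mul]
    refine Finset.sum_congr rfl fun ⟨i, j⟩ hij => ?_
    have hij' : i.degree + j.degree = m + n := by
      rw [← hd, ← Finset.HasAntidiagonal.mem_antidiagonal.1 hij, map_add]
    simp only [coeff_homogeneousComponent]
    rcases lt_trichotomy i.degree m with hi | hi | hi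
    · have : coeff j h = 0 := coeff_eq_zero_of_totalDegree_lt (by
        rw [← Finsupp.degree_apply]; omega)
      simp [this]
    · rw [if_pos hi, if_pos (by omega)]
    · have : coeff i g = 0 := coeff_eq_zero_of_totalDegree_lt (by
        rw [← Finsupp.degree_apply]; omega)
      simp [this]
  · rw [coeff_homogeneousComponent, if_neg hd]
    exact (((homogeneousComponent_isHomogeneous m g).mul
      (homogeneousComponent_isHomogeneous n h)).coeff_eq_zero hd).symm

theorem IsHomogeneous.eval_eq_sum_piAntidiag {σ R : Type*} [CommSemiring R]
    [Fintype σ] [DecidableEq σ] {p : MvPolynomial σ R} {n : ℕ} (hp : p.IsHomogeneous n)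
    (x : σ → R) :
    eval x p = ∑ d ∈ Finset.piAntidiag Finset.univ n,
      coeff (Finsupp.equivFunOnFinite.symm d) p * ∏ i, x i ^ d i := by
  classical
  rw [eval_eq']
  refine Finset.sum_of_injOn (fun d => ⇑d) DFunLike.coe_injective.injOn ?_ ?_ ?_
  · intro d hd
    rw [Finset.mem_coe, Finset.mem_piAntidiag]
    refine ⟨?_, fun i _ => Finset.mem_univ i⟩
    rw [← Finsupp.degree_eq_sum]
    by_contra hne
    exact mem_support_iff.1 hd (hp.coeff_eq_zero hne)
  · intro d _ hd
    have : coeff (Finsupp.equivFunOnFinite.symm d) p = 0 := by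
      by_contra hne
      exact hd ⟨_, mem_support_iff.2 hne, rfl⟩
    rw [this, zero_mul]
  · intro d _
    rw [Finsupp.equivFunOnFinite_symm_coe]

end MvPolynomial

namespace SpohnCubic

/-- The ternary linear form with the given coefficients. -/
noncomputable def linearForm (α β γ : ℝ) : MvPolynomial (Fin 3) ℝ :=
  C α * X 0 + C β * X 1 + C γ * X 2

/-- The ternary quadratic form with the given coefficients. -/
noncomputable def quadraticForm (q11 q22 q33 q12 q13 q23 : ℝ) : MvPolynomial (Fin 3) ℝ :=
  C q11 * X 0 ^ 2 + C q22 * X 1 ^ 2 + C q33 * X 2 ^ 2 + C q12 * (X 0 * X 1)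
    + C q13 * (X 0 * X 2) + C q23 * (X 1 * X 2)

theorem isHomogeneous_linearForm (α β γ : ℝ) : (linearForm α β γ).IsHomogeneous 1 :=
  ((isHomogeneous_C_mul_X α 0).add (isHomogeneous_C_mul_X β 1)).add (isHomogeneous_C_mul_X γ 2)

theorem isHomogeneous_quadraticForm (q11 q22 q33 q12 q13 q23 : ℝ) :
    (quadraticForm q11 q22 q33 q12 q13 q23).IsHomogeneous 2 := by
  have hX (i j : Fin 3) : (X i * X j : MvPolynomial (Fin 3) ℝ).IsHomogeneous 2 :=
    (isHomogeneous_X ℝ i).mul (isHomogeneous_X ℝ j)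
  exact (((((isHomogeneous_C_mul_X_pow q11 0 2).add (isHomogeneous_C_mul_X_pow q22 1 2)).add
    (isHomogeneous_C_mul_X_pow q33 2 2)).add ((hX 0 1).C_mul q12)).add ((hX 0 2).C_mul q13)).add
    ((hX 1 2).C_mul q23)

theorem exists_eq_linearForm {p : MvPolynomial (Fin 3) ℝ} (hp : p.IsHomogeneous 1) :
    ∃ α β γ, p = linearForm α β γ := by
  have hS : (Finset.piAntidiag Finset.univ 1 : Finset (Fin 3 → ℕ))
      = {![1, 0, 0], ![0, 1, 0], ![0, 0, 1]} := by decide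
  refine ⟨coeff (Finsupp.equivFunOnFinite.symm ![1, 0, 0]) p,
    coeff (Finsupp.equivFunOnFinite.symm ![0, 1, 0]) p,
    coeff (Finsupp.equivFunOnFinite.symm ![0, 0, 1]) p,
    MvPolynomial.funext fun x => ?_⟩
  rw [hp.eval_eq_sum_piAntidiag, hS, Finset.sum_insert (by decide), Finset.sum_insert (by decide),
    Finset.sum_singleton]
  simp only [linearForm, map_add, map_mul, eval_C, eval_X, Fin.prod_univ_three]
  simp [← add_assoc]

theorem exists_eq_quadraticForm {p : MvPolynomial (Fin 3) ℝ} (hp : p.IsHomogeneous 2) :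
    ∃ q11 q22 q33 q12 q13 q23, p = quadraticForm q11 q22 q33 q12 q13 q23 := by
  have hS : (Finset.piAntidiag Finset.univ 2 : Finset (Fin 3 → ℕ))
      = {![2, 0, 0], ![0, 2, 0], ![0, 0, 2], ![1, 1, 0], ![1, 0, 1], ![0, 1, 1]} := by decide
  refine ⟨coeff (Finsupp.equivFunOnFinite.symm ![2, 0, 0]) p,
    coeff (Finsupp.equivFunOnFinite.symm ![0, 2, 0]) p,
    coeff (Finsupp.equivFunOnFinite.symm ![0, 0, 2]) p,
    coeff (Finsupp.equivFunOnFinite.symm ![1, 1, 0]) p,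
    coeff (Finsupp.equivFunOnFinite.symm ![1, 0, 1]) p,
    coeff (Finsupp.equivFunOnFinite.symm ![0, 1, 1]) p,
    MvPolynomial.funext fun x => ?_⟩
  rw [hp.eval_eq_sum_piAntidiag, hS, Finset.sum_insert (by decide), Finset.sum_insert (by decide),
    Finset.sum_insert (by decide), Finset.sum_insert (by decide), Finset.sum_insert (by decide),
    Finset.sum_singleton]
  simp only [quadraticForm, map_add, map_mul, map_pow, eval_C, eval_X, Fin.prod_univ_three]
  simp [← add_assoc]

theorem isHomogeneous_spohnCubic (a11 a12 a21 a22 b11 b12 b21 b22 : ℝ) :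
    (spohnCubic a11 a12 a21 a22 b11 b12 b21 b22).IsHomogeneous 3 := by
  have hX (i j k : Fin 3) : (X i * X j * X k : MvPolynomial (Fin 3) ℝ).IsHomogeneous 3 :=
    ((isHomogeneous_X ℝ i).mul (isHomogeneous_X ℝ j)).mul (isHomogeneous_X ℝ k)
  have hC (r : ℝ) (i j k : Fin 3) :
      (C r * (X i * X j * X k) : MvPolynomial (Fin 3) ℝ).IsHomogeneous 3 := (hX i j k).C_mul r
  convert ((((((hC ((a11 - a22) * (b11 - b12)) 0 0 1).add
    (hC ((a11 - a21) * (b22 - b11)) 0 0 2)).add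
    (hC ((a12 - a22) * (b11 - b12)) 0 1 1)).add
    (hC ((a11 - a21) * (b22 - b21)) 0 2 2)).add
    (hC ((a12 - a22) * (b21 - b12)) 1 1 2)).add
    (hC ((a12 - a21) * (b22 - b21)) 1 2 2)).add
    (hC ((a12 - a21) * (b22 - b11) + (a11 - a22) * (b21 - b12)) 0 1 2) using 1
  rw [spohnCubic]
  ring

theorem spohnCubic_eq_linearForm_mul_quadraticForm_iff
    {a11 a12 a21 a22 b11 b12 b21 b22 α β γ q11 q22 q33 q12 q13 q23 : ℝ} :
    spohnCubic a11 a12 a21 a22 b11 b12 b21 b22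
        = linearForm α β γ * quadraticForm q11 q22 q33 q12 q13 q23 ↔
      (α * q11 = 0 ∧ β * q22 = 0 ∧ γ * q33 = 0) ∧
      (a11 - a22) * (b11 - b12) = α * q12 + β * q11 ∧
      (a11 - a21) * (b22 - b11) = α * q13 + γ * q11 ∧
      (a12 - a22) * (b11 - b12) = α * q22 + β * q12 ∧
      (a11 - a21) * (b22 - b21) = α * q33 + γ * q13 ∧
      (a12 - a22) * (b21 - b12) = β * q23 + γ * q22 ∧
      (a12 - a21) * (b22 - b21) = β * q33 + γ * q23 ∧
      (a12 - a21) * (b22 - b11) + (a11 - a22) * (b21 - b12)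
        = α * q23 + β * q13 + γ * q12 := by
  constructor
  · intro h
    have e (x y z : ℝ) := congrArg (eval ![x, y, z]) h
    simp only [spohnCubic, linearForm, quadraticForm, map_add, map_mul, map_pow, eval_C, eval_X,
      Matrix.cons_val_zero, Matrix.cons_val_one, Matrix.cons_val] at e
    have e1 := e 1 0 0
    have e2 := e 0 1 0
    have e3 := e 0 0 1
    have e4 := e 1 1 0
    have e5 := e 1 (-1) 0
    have e6 := e 1 0 1
    have e7 := e 1 0 (-1)
    have e8 := e 0 1 1
    have e9 := e 0 1 (-1)
    have e10 := e 1 1 1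
    refine ⟨⟨?_, ?_, ?_⟩, ?_, ?_, ?_, ?_, ?_, ?_, ?_⟩ <;> linarith
  · rintro ⟨⟨h1, h2, h3⟩, c1, c2, c3, c4, c5, c6, c7⟩
    have k1 := congrArg (C (σ := Fin 3)) h1
    have k2 := congrArg (C (σ := Fin 3)) h2
    have k3 := congrArg (C (σ := Fin 3)) h3
    rw [spohnCubic, c1, c2, c3, c4, c5, c6, c7, linearForm, quadraticForm]
    simp only [map_add, map_mul, map_zero] at k1 k2 k3 ⊢
    linear_combination -X 0 ^ 3 * k1 - X 1 ^ 3 * k2 - X 2 ^ 3 * k3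

theorem exists_linearForm_mul_quadraticForm_iff {f : MvPolynomial (Fin 3) ℝ} (hf : f ≠ 0)
    (hf3 : f.IsHomogeneous 3) :
    (∃ g h : MvPolynomial (Fin 3) ℝ, 0 < g.totalDegree ∧ 0 < h.totalDegree ∧ f = g * h) ↔
      ∃ α β γ q11 q22 q33 q12 q13 q23,
        f = linearForm α β γ * quadraticForm q11 q22 q33 q12 q13 q23 := by
  constructor
  · suffices H : ∀ g h : MvPolynomial (Fin 3) ℝ, g.totalDegree = 1 → h.totalDegree = 2 →
        f = g * h → ∃ α β γ q11 q22 q33 q12 q13 q23,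
          f = linearForm α β γ * quadraticForm q11 q22 q33 q12 q13 q23 by
      rintro ⟨g, h, hg, hh, rfl⟩
      have hdeg := totalDegree_mul_of_isDomain (left_ne_zero_of_mul hf) (right_ne_zero_of_mul hf)
      rw [hf3.totalDegree hf] at hdeg
      obtain hg1 | hg2 : g.totalDegree = 1 ∨ g.totalDegree = 2 := by omega
      · exact H g h hg1 (by omega) rfl
      · exact H h g (by omega) hg2 (mul_comm g h)
    intro g h hg hh hgh
    obtain ⟨α, β, γ, hl⟩ := exists_eq_linearForm (homogeneousComponent_isHomogeneous 1 g)
    obtain ⟨q11, q22, q33, q12, q13, q23, hq⟩ :=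
      exists_eq_quadraticForm (homogeneousComponent_isHomogeneous 2 h)
    refine ⟨α, β, γ, q11, q22, q33, q12, q13, q23, ?_⟩
    rw [← hl, ← hq, ← homogeneousComponent_add_mul hg.le hh.le, ← hgh]
    exact (homogeneousComponent_eq_self hf3).symm
  · rintro ⟨α, β, γ, q11, q22, q33, q12, q13, q23, rfl⟩
    refine ⟨_, _, ?_, ?_, rfl⟩
    · rw [(isHomogeneous_linearForm α β γ).totalDegree (left_ne_zero_of_mul hf)]
      exact one_pos
    · rw [(isHomogeneous_quadraticForm _ _ _ _ _ _).totalDegree (right_ne_zero_of_mul hf)]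
      exact two_pos

theorem of_forall_ne_zero {a s p e t r α β γ u v w : ℝ} (h1 : a ≠ s) (h2 : a ≠ p)
    (h4 : e ≠ t) (h5 : e ≠ r) (hα : α ≠ 0)
    (hβ : β ≠ 0) (hγ : γ ≠ 0)
    (c1 : a * (e - t) = α * u) (c2 : -((a - p) * e) = α * v) (c3 : s * (e - t) = β * u)
    (c4 : -((a - p) * r) = γ * v) (c5 : s * (r - t) = β * w) (c6 : -((s - p) * r) = γ * w)
    (c7 : -((s - p) * e) + a * (r - t) = α * w + β * v + γ * u) :
    (p * t = s * r ∧ p * e = a * r ∧ s * e = a * t) ∨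
    (a * (t - r) - s * t + p * r = 0 ∧ s * (e - t) + p * (r - e) = 0 ∧
      a * (e - r) - s * t + p * (r - e) = 0) := by
  have k1 : β * a = α * s := by
    apply mul_right_cancel₀ (sub_ne_zero.2 h4); linear_combination β * c1 - α * c3
  have k2 : γ * e = α * r := by
    apply mul_right_cancel₀ (sub_ne_zero.2 h2); linear_combination -γ * c2 + α * c4
  have ha : a ≠ 0 := by rintro rfl; grind
  have hs : s ≠ 0 := by rintro rfl; grind
  have he : e ≠ 0 := by rintro rfl; grind
  have hr : r ≠ 0 := by rintro rfl; grind
  have k3 : a * (r - t) = α * w := by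
    apply mul_right_cancel₀ hs; linear_combination a * c5 + w * k1
  have k4 : -((s - p) * e) = α * w := by
    apply mul_right_cancel₀ hr; linear_combination e * c6 + w * k2
  have E2 : a ^ 2 * (r * t - e * t) + s * e ^ 2 * (a - p) = 0 := by
    linear_combination a*e*c7 - a*e*k4 +e*v*k1 + a*u*k2 - s * e*c2-r*a*c1
  have E : (s * e - a * t) * (s * e + a * r - a * e) = 0 := by
    linear_combination -E2 - s*e * (k4-k3)
  rcases mul_eq_zero.1 E with h | h
  · have k5 : p * e = a * r := by linear_combination h + k4 - k3
    refine .inl ⟨?_, k5, by linear_combination h⟩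
    apply mul_right_cancel₀ (mul_ne_zero ha he)
    linear_combination a * t * k5 - a * r * h
  · have k5 : s * e = a * (e - r) := by linear_combination h
    have k6 : p * e = a * (e - t) := by linear_combination h + k4 - k3
    refine .inr ⟨?_, ?_, ?_⟩ <;> apply mul_right_cancel₀ he
    · linear_combination -t * k5 + r * k6
    · linear_combination (e - t) * k5 + (r - e) * k6
    · linear_combination -t * k5 + (r - e) * k6

theorem false_of_third_eq_zero {a s p e t r α β q u v w : ℝ} (h1 : a ≠ s) (h2 : a ≠ p) (h3 : p ≠ 0)
    (h4 : e ≠ t) (h5 : e ≠ r) (hα : α ≠ 0) (hβ : β ≠ 0)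
    (c1 : a * (e - t) = α * u) (c2 : -((a - p) * e) = α * v) (c3 : s * (e - t) = β * u)
    (c4 : -((a - p) * r) = α * q) (c5 : s * (r - t) = β * w) (c6 : -((s - p) * r) = β * q)
    (c7 : -((s - p) * e) + a * (r - t) = α * w + β * v) : False := by
  have k1 : β * a = α * s := by
    apply mul_right_cancel₀ (sub_ne_zero.2 h4); linear_combination β * c1 - α * c3
  have ha : a ≠ 0 := by rintro rfl; grind
  have hs : s ≠ 0 := by rintro rfl; grind
  grind

theorem false_of_second_eq_zero {a s p e t r α γ q u v w : ℝ} (h1 : a ≠ s) (h2 : a ≠ p) (h6 : t ≠ 0)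
    (h4 : e ≠ t) (h5 : e ≠ r) (hα : α ≠ 0) (hγ : γ ≠ 0)
    (c1 : a * (e - t) = α * u) (c2 : -((a - p) * e) = α * v) (c3 : s * (e - t) = α * q)
    (c4 : -((a - p) * r) = γ * v) (c5 : s * (r - t) = γ * q) (c6 : -((s - p) * r) = γ * w)
    (c7 : -((s - p) * e) + a * (r - t) = α * w + γ * u) : False := by
  have k2 : γ * e = α * r := by
    apply mul_right_cancel₀ (sub_ne_zero.2 h2); linear_combination -γ * c2 + α * c4
  have he : e ≠ 0 := by rintro rfl; grind
  have hr : r ≠ 0 := by rintro rfl; grind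
  grind

theorem of_first_eq_zero {a s p e t r β γ q u v w : ℝ} (h1 : a ≠ s) (h2 : a ≠ p) (h3 : p ≠ 0)
    (h4 : e ≠ t) (h5 : e ≠ r) (h6 : t ≠ 0) (hβ : β ≠ 0) (hγ : γ ≠ 0)
    (c1 : a * (e - t) = β * q) (c2 : -((a - p) * e) = γ * q) (c3 : s * (e - t) = β * u)
    (c4 : -((a - p) * r) = γ * v) (c5 : s * (r - t) = β * w) (c6 : -((s - p) * r) = γ * w)
    (c7 : -((s - p) * e) + a * (r - t) = β * v + γ * u) :
    (s * t = p * r ∧ a * t = p * e ∧ a * r = s * e) ∨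
    (a * (t - r) + s * r - p * t = 0 ∧ s * (e - r) + p * (t - e) = 0 ∧
      a * (e - r) - p * e = 0) := by
  have k1 : a * (e - t) * γ = -((a - p) * e * β) := by linear_combination γ * c1 - β * c2
  have k2 : s * (r - t) * γ = -((s - p) * r * β) := by linear_combination γ * c5 - β * c6
  have k3 : (-((s - p) * e) + a * (r - t)) * (β * γ)
      = -(β ^ 2 * ((a - p) * r)) + γ ^ 2 * (s * (e - t)) := by
    linear_combination β * γ * c7 - β ^ 2 * c4 - γ ^ 2 * c3
  by_cases ha : a = 0
  · subst ha
    have he : e = 0 := by grind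
    subst he
    have k : (s * r - p * t) * (s * t - p * r) = 0 := by
      apply mul_right_cancel₀ (mul_ne_zero (mul_ne_zero h1.symm h5.symm) (pow_ne_zero 2 hγ))
      linear_combination -p * r * (s * (r - t) * γ - (s - p) * r * β) * k2
        + (s - p) ^ 2 * r ^ 2 * k3
    rcases mul_eq_zero.1 k with h | h
    · exact .inr ⟨by linear_combination h, by linear_combination -h, by ring⟩
    · exact .inl ⟨by linear_combination h, by ring, by ring⟩
  · have he : e ≠ 0 := by rintro rfl; grind
    have G : p * e ^ 2 * (a - s) - a ^ 2 * t * (e - r) = 0 := by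
      apply mul_right_cancel₀ (mul_ne_zero hβ hγ)
      linear_combination a * e * k3 - r * a * β * k1 + s * e * γ * k1
    have H : a * (e - t) * (s - p) * r - s * (r - t) * (a - p) * e = 0 := by
      apply mul_right_cancel₀ (mul_ne_zero hβ hγ)
      linear_combination (s - p) * r * β * k1 - (a - p) * e * β * k2
    have k : (a * r + p * e - a * e) * (a * r - s * e) = 0 := by
      apply mul_right_cancel₀ h6
      linear_combination e * H + r * G
    rcases mul_eq_zero.1 k with h | h
    · have U : a * t + s * e - a * e = 0 := by
        apply mul_right_cancel₀ (mul_ne_zero h3 he)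
        linear_combination t * a * h - G
      refine .inr ⟨?_, ?_, by linear_combination -h⟩ <;> apply mul_right_cancel₀ he
      · linear_combination r * U - t * h
      · linear_combination (e - r) * U + (t - e) * h
    · have k5 : a * t = p * e := by
        apply mul_right_cancel₀ (mul_ne_zero ha (sub_ne_zero.2 h5))
        linear_combination -G + p * e * h
      refine .inl ⟨?_, k5, by linear_combination h⟩
      apply mul_right_cancel₀ (mul_ne_zero ha he)
      linear_combination s * e * k5 - p * e * h

theorem of_exists_factors {a s p e t r α β γ q11 q22 q33 q12 q13 q23 : ℝ} (h1 : a ≠ s) (h2 : a ≠ p)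
    (h3 : p ≠ 0) (h4 : e ≠ t) (h5 : e ≠ r) (h6 : t ≠ 0) (h7 : ¬ (s = 0 ∧ r = 0))
    (h8 : ¬ (s = p ∧ t = r)) (hl : ¬ (α = 0 ∧ β = 0 ∧ γ = 0))
    (hx : α * q11 = 0) (hy : β * q22 = 0) (hz : γ * q33 = 0)
    (c1 : a * (e - t) = α * q12 + β * q11) (c2 : -((a - p) * e) = α * q13 + γ * q11)
    (c3 : s * (e - t) = α * q22 + β * q12) (c4 : -((a - p) * r) = α * q33 + γ * q13)
    (c5 : s * (r - t) = β * q23 + γ * q22) (c6 : -((s - p) * r) = β * q33 + γ * q23)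
    (c7 : -((s - p) * e) + a * (r - t) = α * q23 + β * q13 + γ * q12) :
    (s * t = p * r ∧ a * t = p * e ∧ a * r = s * e) ∨
    (a * (t - r) + s * r - p * t = 0 ∧ s * (e - r) + p * (t - e) = 0 ∧
      a * (e - r) - p * e = 0) ∨
    (p * t = s * r ∧ p * e = a * r ∧ s * e = a * t) ∨
    (a * (t - r) - s * t + p * r = 0 ∧ s * (e - t) + p * (r - e) = 0 ∧
      a * (e - r) - s * t + p * (r - e) = 0) := by
  by_cases hα : α = 0 <;> by_cases hβ : β = 0 <;> by_cases hγ : γ = 0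
  · exact absurd ⟨hα, hβ, hγ⟩ hl
  · obtain rfl : q33 = 0 := (mul_eq_zero.1 hz).resolve_left hγ
    simp only [hα, hβ, zero_mul, mul_zero, add_zero, zero_add] at *
    grind
  · obtain rfl : q22 = 0 := (mul_eq_zero.1 hy).resolve_left hβ
    simp only [hα, hγ, zero_mul, mul_zero, add_zero, zero_add] at *
    grind
  · obtain rfl : q22 = 0 := (mul_eq_zero.1 hy).resolve_left hβ
    obtain rfl : q33 = 0 := (mul_eq_zero.1 hz).resolve_left hγ
    simp only [hα, zero_mul, mul_zero, add_zero, zero_add] at c1 c2 c3 c4 c5 c6 c7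
    rcases of_first_eq_zero h1 h2 h3 h4 h5 h6 hβ hγ c1 c2 c3 c4 c5 c6 c7 with h | h
    · exact .inl h
    · exact .inr (.inl h)
  · obtain rfl : q11 = 0 := (mul_eq_zero.1 hx).resolve_left hα
    simp only [hβ, hγ, zero_mul, add_zero] at c5 c6
    rcases mul_eq_zero.1 c5 with hs | hr
    · exact (h3 (by grind)).elim
    · exact (h8 (by grind)).elim
  · obtain rfl : q11 = 0 := (mul_eq_zero.1 hx).resolve_left hα
    obtain rfl : q33 = 0 := (mul_eq_zero.1 hz).resolve_left hγ
    simp only [hβ, zero_mul, mul_zero, add_zero, zero_add] at c1 c2 c3 c4 c5 c6 c7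
    exact (false_of_second_eq_zero h1 h2 h6 h4 h5 hα hγ c1 c2 c3 c4 c5 c6 c7).elim
  · obtain rfl : q11 = 0 := (mul_eq_zero.1 hx).resolve_left hα
    obtain rfl : q22 = 0 := (mul_eq_zero.1 hy).resolve_left hβ
    simp only [hγ, zero_mul, mul_zero, add_zero, zero_add] at c1 c2 c3 c4 c5 c6 c7
    exact (false_of_third_eq_zero h1 h2 h3 h4 h5 hα hβ c1 c2 c3 c4 c5 c6 c7).elim
  · obtain rfl : q11 = 0 := (mul_eq_zero.1 hx).resolve_left hα
    obtain rfl : q22 = 0 := (mul_eq_zero.1 hy).resolve_left hβ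
    obtain rfl : q33 = 0 := (mul_eq_zero.1 hz).resolve_left hγ
    simp only [mul_zero, add_zero, zero_add] at c1 c2 c3 c4 c5 c6 c7
    rcases of_forall_ne_zero h1 h2 h4 h5 hα hβ hγ c1 c2 c3 c4 c5 c6 c7 with h | h
    · exact .inr (.inr (.inl h))
    · exact .inr (.inr (.inr h))

end SpohnCubic

open SpohnCubic in
/-- Classification of reducibility of the Spohn cubic: a nonzero Spohn cubic is a
product of two non-constant polynomials in `ℝ[x, y, z]` if and only if one of the
twelve listed conditions on the payoff matrices holds. -/
theorem spohnCubic_reducible_iff (a11 a12 a21 a22 b11 b12 b21 b22 : ℝ)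
    (hf : spohnCubic a11 a12 a21 a22 b11 b12 b21 b22 ≠ 0) :
    (∃ g h : MvPolynomial (Fin 3) ℝ, 0 < g.totalDegree ∧ 0 < h.totalDegree ∧
        spohnCubic a11 a12 a21 a22 b11 b12 b21 b22 = g * h) ↔
      (a11 = a12 ∨
       a11 = a21 ∨
       a21 = a22 ∨
       b11 = b12 ∨
       b11 = b21 ∨
       b12 = b22 ∨
       (a12 = a22 ∧ b21 = b22) ∨
       (a12 = a21 ∧ b12 = b21) ∨
       (a12 * (b12 - b22) + a21 * (b22 - b21) + a22 * (b21 - b12) = 0 ∧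
        a11 * (b22 - b12) + a21 * (b11 - b22) + a22 * (b12 - b11) = 0 ∧
        a11 * (b22 - b21) + a12 * (b11 - b22) + a22 * (b21 - b11) = 0) ∨
       (a11 * (b12 - b21) + a12 * (b21 - b22) + a21 * (b22 - b12) = 0 ∧
        a12 * (b11 - b21) + a21 * (b12 - b11) + a22 * (b21 - b12) = 0 ∧
        a11 * (b11 - b21) + a21 * (b22 - b11) + a22 * (b21 - b22) = 0) ∨
       (a12 * (b22 - b21) + a21 * (b12 - b22) + a22 * (b21 - b12) = 0 ∧
        a11 * (b22 - b21) + a21 * (b11 - b22) + a22 * (b21 - b11) = 0 ∧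
        a11 * (b22 - b12) + a12 * (b11 - b22) + a22 * (b12 - b11) = 0) ∨
       (a11 * (b12 - b21) + a12 * (b22 - b12) + a21 * (b21 - b22) = 0 ∧
        a12 * (b11 - b12) + a21 * (b21 - b11) + a22 * (b12 - b21) = 0 ∧
        a11 * (b11 - b21) + a12 * (b22 - b12) + a21 * (b21 - b11) + a22 * (b12 - b22)
          = 0)) := by
  rw [exists_linearForm_mul_quadraticForm_iff hf (isHomogeneous_spohnCubic _ _ _ _ _ _ _ _)]
  constructor
  · rintro ⟨α, β, γ, q11, q22, q33, q12, q13, q23, h⟩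
    by_contra! hn
    obtain ⟨n1, n2, n3, n4, n5, n6, n7, n8, n9, n10, n11, n12⟩ := hn
    have hl : ¬ (α = 0 ∧ β = 0 ∧ γ = 0) := by
      rintro ⟨rfl, rfl, rfl⟩
      exact hf (by simp [h, linearForm])
    obtain ⟨⟨hx, hy, hz⟩, c1, c2, c3, c4, c5, c6, c7⟩ :=
      spohnCubic_eq_linearForm_mul_quadraticForm_iff.1 h
    have key := of_exists_factors (a := a11 - a22) (s := a12 - a22) (p := a21 - a22)
      (e := b11 - b22) (t := b12 - b22) (r := b21 - b22) (q12 := q12)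
      (q13 := q13) (q23 := q23) (by grind) (by grind) (by grind)
      (by grind) (by grind) (by grind) (by grind) (by grind) hl hx hy hz
      (by linear_combination c1) (by linear_combination c2) (by linear_combination c3)
      (by linear_combination c4) (by linear_combination c5) (by linear_combination c6)
      (by linear_combination c7)
    rcases key with ⟨k1, k2, k3⟩ | ⟨k1, k2, k3⟩ | ⟨k1, k2, k3⟩ | ⟨k1, k2, k3⟩
    · exact n9 (by linear_combination k1) (by linear_combination -k2)
        (by linear_combination -k3)
    · exact n10 (by linear_combination k1) (by linear_combination k2) (by linear_combination k3)
    · exact n11 (by linear_combination k1) (by linear_combination k2)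
        (by linear_combination k3)
    · exact n12 (by linear_combination k1) (by linear_combination k2) (by linear_combination k3)
  · simp only [spohnCubic_eq_linearForm_mul_quadraticForm_iff]
    by_cases h3 : a21 = a22
    · intro _
      refine ⟨a11 - a22, a12 - a22, 0, 0, 0, b22 - b21, b11 - b12, b22 - b11, b21 - b12,
        ⟨?_, ?_, ?_⟩, ?_, ?_, ?_, ?_, ?_, ?_, ?_⟩ <;> subst h3 <;> ring
    by_cases h4 : b11 = b12
    · intro _
      refine ⟨0, 0, 1, (a11 - a21) * (b22 - b11), (a12 - a22) * (b21 - b12), 0,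
        (a12 - a21) * (b22 - b11) + (a11 - a22) * (b21 - b12), (a11 - a21) * (b22 - b21),
        (a12 - a21) * (b22 - b21), ⟨?_, ?_, ?_⟩, ?_, ?_, ?_, ?_, ?_, ?_, ?_⟩ <;> subst h4 <;> ring
    by_cases h5 : b11 = b21
    · intro _
      refine ⟨1, 0, 1, 0, (a12 - a22) * (b11 - b12), 0, (a11 - a22) * (b11 - b12),
        (a11 - a21) * (b22 - b11), (a12 - a21) * (b22 - b11), ⟨?_, ?_, ?_⟩, ?_, ?_, ?_, ?_, ?_, ?_,
        ?_⟩ <;> subst h5 <;> ring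
    by_cases h6 : b12 = b22
    · intro _
      refine ⟨b11 - b22, 0, b21 - b22, 0, a12 - a22, 0, a11 - a22, a21 - a11, a21 - a12,
        ⟨?_, ?_, ?_⟩, ?_, ?_, ?_, ?_, ?_, ?_, ?_⟩ <;> subst h6 <;> ring
    rintro (h | h | h | h | h | h | ⟨h, k⟩ | ⟨h, k⟩ | ⟨k1, k2, k3⟩ | ⟨k1, k2, k3⟩ | ⟨k1, k2, k3⟩ |
      ⟨k1, k2, k3⟩)
    · refine ⟨1, 1, 0, 0, 0, (a11 - a21) * (b22 - b21), (a11 - a22) * (b11 - b12),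
        (a11 - a21) * (b22 - b11), (a12 - a22) * (b21 - b12), ⟨?_, ?_, ?_⟩, ?_, ?_, ?_, ?_, ?_, ?_,
        ?_⟩ <;> subst h <;> ring
    · refine ⟨0, 1, 0, (a11 - a22) * (b11 - b12), 0, (a12 - a21) * (b22 - b21),
        (a12 - a22) * (b11 - b12), (a12 - a21) * (b22 - b11) + (a11 - a22) * (b21 - b12),
        (a12 - a22) * (b21 - b12), ⟨?_, ?_, ?_⟩, ?_, ?_, ?_, ?_, ?_, ?_, ?_⟩ <;> subst h <;> ring
    · exact absurd h h3
    · exact absurd h h4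
    · exact absurd h h5
    · exact absurd h h6
    iterate 2
      refine ⟨1, 0, 0, 0, (a12 - a22) * (b11 - b12), (a11 - a21) * (b22 - b21),
        (a11 - a22) * (b11 - b12), (a11 - a21) * (b22 - b11),
        (a12 - a21) * (b22 - b11) + (a11 - a22) * (b21 - b12), ⟨?_, ?_, ?_⟩, ?_, ?_, ?_, ?_, ?_, ?_,
        ?_⟩ <;> subst h k <;> ring
    · refine ⟨0, 1, -1, (a11 - a22) * (b11 - b12), 0, 0, (a12 - a22) * (b11 - b12),
        (a12 - a22) * (b11 - b12), (a12 - a22) * (b21 - b12), ⟨by ring, by ring, by ring⟩, by ring,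
        ?_, by ring, ?_, by ring, ?_, ?_⟩
      · linear_combination k2
      · linear_combination k3 - k1
      · linear_combination -k1
      · linear_combination k2 - k3
    · have hd : b11 - b21 ≠ 0 := sub_ne_zero.2 h5
      obtain ⟨c, hp⟩ : ∃ c, a21 - a22 = c * (b11 - b21) :=
        ⟨_, (div_mul_cancel₀ (a21 - a22) hd).symm⟩
      obtain rfl : a21 = a22 + c * (b11 - b21) := by linear_combination hp
      obtain rfl : a11 = a22 + c * (b11 - b22) := by
        apply mul_right_cancel₀ hd; linear_combination k3
      obtain rfl : a12 = a22 + c * (b11 - b12) := by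
        apply mul_right_cancel₀ hd; linear_combination k2
      refine ⟨0, b11 - b12, b22 - b21, c * (b11 - b22), 0, 0, c * (b11 - b12), c * (b21 - b22),
        c * (b21 - b12), ⟨?_, ?_, ?_⟩, ?_, ?_, ?_, ?_, ?_, ?_, ?_⟩ <;> ring
    · have hd : b12 - b22 ≠ 0 := sub_ne_zero.2 h6
      obtain ⟨c, hs⟩ : ∃ c, a12 - a22 = c * (b12 - b22) :=
        ⟨_, (div_mul_cancel₀ (a12 - a22) hd).symm⟩
      obtain rfl : a12 = a22 + c * (b12 - b22) := by linear_combination hs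
      obtain rfl : a11 = a22 + c * (b11 - b22) := by
        apply mul_right_cancel₀ hd; linear_combination -k3
      obtain rfl : a21 = a22 + c * (b21 - b22) := by
        apply mul_right_cancel₀ hd; linear_combination k1
      refine ⟨b11 - b22, b12 - b22, b21 - b22, 0, 0, 0, c * (b11 - b12), c * (b21 - b11),
        c * (b21 - b12), ⟨?_, ?_, ?_⟩, ?_, ?_, ?_, ?_, ?_, ?_, ?_⟩ <;> ring
    · have hd : b11 - b12 ≠ 0 := sub_ne_zero.2 h4
      have hd' : b11 - b21 ≠ 0 := sub_ne_zero.2 h5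
      obtain ⟨c, hp⟩ : ∃ c, a21 - a22 = c * (b11 - b12) :=
        ⟨_, (div_mul_cancel₀ (a21 - a22) hd).symm⟩
      obtain rfl : a21 = a22 + c * (b11 - b12) := by linear_combination hp
      obtain rfl : a12 = a22 + c * (b11 - b21) := by
        apply mul_right_cancel₀ hd; linear_combination k2
      obtain rfl : a11 = a22 + c * (b11 - b22) := by
        apply mul_right_cancel₀ hd'; linear_combination k3
      refine ⟨b11 - b22, b11 - b21, b21 - b22, 0, 0, 0, c * (b11 - b12), c * (b22 - b12),
        c * (b21 - b12), ⟨?_, ?_, ?_⟩, ?_, ?_, ?_, ?_, ?_, ?_, ?_⟩ <;> ring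
end

section
/- Let f be the Spohn cubic of a 2×2 game with real payoff matrices A = (a_{ij}), B = (b_{ij}), with f ≠ 0, and let f_ℂ denote the image of f in ℂ[x,y,z] under coefficient extension. Then for every irreducible polynomial g ∈ ℂ[x,y,z] dividing f_ℂ, there exists a point p = (p₁,p₂,p₃) ∈ ℝ³ with p ≠ 0 such that g(p₁,p₂,p₃) = 0 and the gradient (∂g/∂x, ∂g/∂y, ∂g/∂z) evaluated at (p₁,p₂,p₃) is nonzero. (Every irreducible component of the Spohn cubic contains a smooth point with real coordinates.) -/
open MvPolynomial

namespace MvPolynomial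

section Homogenization

variable {σ R : Type*} [CommRing R]

/-- The homomorphism `p ↦ ∑ₖ pₖ Tᵏ`, where `pₖ` is the homogeneous component of `p` of
degree `k`. -/
noncomputable def gradingHom (σ R : Type*) [CommRing R] :
    MvPolynomial σ R →ₐ[R] Polynomial (MvPolynomial σ R) :=
  aeval fun i => Polynomial.C (X i) * Polynomial.X

theorem gradingHom_monomial (d : σ →₀ ℕ) (r : R) :
    gradingHom σ R (monomial d r) = Polynomial.monomial d.degree (monomial d r) := by
  have h : (algebraMap R (Polynomial (MvPolynomial σ R))) r = Polynomial.C (C r) := rfl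
  rw [gradingHom, aeval_monomial, h, monomial_eq (s := d), ← Polynomial.C_mul_X_pow_eq_monomial]
  simp only [Finsupp.prod, mul_pow, Finset.prod_mul_distrib, Finset.prod_pow_eq_pow_sum,
    Finsupp.degree_apply, map_mul, map_prod, map_pow, mul_assoc]

theorem coeff_coeff_gradingHom (p : MvPolynomial σ R) (k : ℕ) (d : σ →₀ ℕ) :
    coeff d ((gradingHom σ R p).coeff k) = if d.degree = k then coeff d p else 0 := by
  classical
  induction p using MvPolynomial.induction_on' with
  | monomial u a =>
    rw [gradingHom_monomial, Polynomial.coeff_monomial]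
    by_cases hu : u = d
    · subst hu
      split_ifs <;> simp
    · split_ifs <;> simp [coeff_monomial, hu]
  | add p q hp hq =>
    rw [map_add, Polynomial.coeff_add, coeff_add, hp, hq, coeff_add]
    split_ifs <;> simp

theorem isHomogeneous_iff_gradingHom_eq {p : MvPolynomial σ R} {n : ℕ} :
    p.IsHomogeneous n ↔ gradingHom σ R p = Polynomial.monomial n p := by
  refine ⟨fun h => ?_, fun h d hd => ?_⟩
  · ext k d
    rw [coeff_coeff_gradingHom, Polynomial.coeff_monomial]
    by_cases hk : n = k
    · subst hk
      rw [if_pos rfl]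
      split_ifs with hd
      · rfl
      · exact (h.coeff_eq_zero hd).symm
    · rw [if_neg hk]
      split_ifs with hd
      · exact h.coeff_eq_zero (fun h' => hk (h'.symm.trans hd))
      · simp
  · change Finsupp.weight (fun _ => 1) d = n
    rw [← Finsupp.degree_eq_weight_one]
    by_contra hne
    have := coeff_coeff_gradingHom p d.degree d
    rw [h, Polynomial.coeff_monomial, if_neg (fun h' => hne h'.symm), if_pos rfl] at this
    exact hd (by simpa using this.symm)

theorem gradingHom_eval_one (p : MvPolynomial σ R) : (gradingHom σ R p).eval 1 = p := by
  induction p using MvPolynomial.induction_on' with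
  | monomial u a => simp [gradingHom_monomial]
  | add p q hp hq => rw [map_add, Polynomial.eval_add, hp, hq]

/-- A factor of a nonzero homogeneous polynomial over a domain is homogeneous. -/
theorem IsHomogeneous.of_mul_left [IsDomain R] {p q : MvPolynomial σ R} {n : ℕ}
    (h : (p * q).IsHomogeneous n) (hpq : p * q ≠ 0) : ∃ m, p.IsHomogeneous m := by
  have hne : ∀ r : MvPolynomial σ R, r ≠ 0 → gradingHom σ R r ≠ 0 := fun r hr h0 =>
    hr (by rw [← gradingHom_eval_one r, h0, Polynomial.eval_zero])
  have hp := hne p (left_ne_zero_of_mul hpq)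
  have hq := hne q (right_ne_zero_of_mul hpq)
  have hmul := isHomogeneous_iff_gradingHom_eq.mp h
  rw [map_mul] at hmul
  have hdeg := congrArg Polynomial.natDegree hmul
  have htdeg := congrArg Polynomial.natTrailingDegree hmul
  rw [Polynomial.natDegree_mul hp hq, Polynomial.natDegree_monomial_eq n hpq] at hdeg
  rw [Polynomial.natTrailingDegree_mul hp hq, Polynomial.natTrailingDegree_monomial hpq] at htdeg
  have hp' := Polynomial.natTrailingDegree_le_natDegree (gradingHom σ R p)
  have hq' := Polynomial.natTrailingDegree_le_natDegree (gradingHom σ R q)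
  refine ⟨(gradingHom σ R p).natDegree, fun d hd => ?_⟩
  have hcoeff : (gradingHom σ R p).coeff d.degree ≠ 0 := fun h0 => hd (by
    have := coeff_coeff_gradingHom p d.degree d
    rw [h0, if_pos rfl] at this
    simpa using this.symm)
  have h1 := Polynomial.le_natDegree_of_ne_zero hcoeff
  have h2 := Polynomial.natTrailingDegree_le_of_ne_zero hcoeff
  change Finsupp.weight (fun _ => 1) d = _
  rw [← Finsupp.degree_eq_weight_one]
  omega

end Homogenization

section LowDegree

variable {σ K : Type*} [Fintype σ]

theorem IsHomogeneous.exists_eq_sum_C_mul_X [CommRing K] {p : MvPolynomial σ K}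
    (h : p.IsHomogeneous 1) : ∃ a : σ → K, p = ∑ i, C (a i) * X i := by
  have hC : ∀ i, pderiv i p = C (coeff 0 (pderiv i p)) := fun i =>
    totalDegree_eq_zero_iff_eq_C.mp ((totalDegree_zero_iff_isHomogeneous _).mpr h.pderiv)
  refine ⟨fun i => coeff 0 (pderiv i p), ?_⟩
  have := h.sum_X_mul_pderiv
  rw [one_smul] at this
  rw [← this]
  refine Finset.sum_congr rfl fun i _ => ?_
  rw [this, ← hC i, mul_comm]

theorem IsHomogeneous.exists_eq_sum_sum_C_mul_X_mul_X [Field K] [CharZero K]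
    {p : MvPolynomial σ K} (h : p.IsHomogeneous 2) :
    ∃ a : σ → σ → K, p = ∑ i, ∑ j, C (a i j) * X i * X j := by
  have hlin : ∀ i, ∃ a : σ → K, pderiv i p = ∑ j, C (a j) * X j := fun i =>
    (h.pderiv (i := i)).exists_eq_sum_C_mul_X
  choose a ha using hlin
  refine ⟨fun i j => 2⁻¹ * a i j, ?_⟩
  have hE := h.sum_X_mul_pderiv
  have h2 : (C (2⁻¹) * 2 : MvPolynomial σ K) = 1 := by
    rw [← map_ofNat (C : K →+* MvPolynomial σ K) 2, ← map_mul, inv_mul_cancel₀ two_ne_zero, map_one]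
  calc p = C (2⁻¹) * (2 • p) := by rw [two_nsmul, ← two_mul, ← mul_assoc, h2, one_mul]
    _ = _ := by
      rw [← hE, Finset.mul_sum]
      refine Finset.sum_congr rfl fun i _ => ?_
      rw [ha, Finset.mul_sum, Finset.mul_sum]
      refine Finset.sum_congr rfl fun j _ => ?_
      rw [map_mul]
      ring

end LowDegree

theorem not_irreducible_mul_of_eval_zero {σ K : Type*} [Field K] {p q : MvPolynomial σ K}
    (hp : eval 0 p = 0) (hq : eval 0 q = 0) : ¬ Irreducible (p * q) := fun h => by
  rcases h.isUnit_or_isUnit rfl with hu | hu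
  · exact (hu.map (eval 0)).ne_zero hp
  · exact (hu.map (eval 0)).ne_zero hq

theorem not_irreducible_binary_quadratic {σ : Type*} (i j : σ) (a b c : ℂ) :
    ¬ Irreducible (C a * X i ^ 2 + C b * X i * X j + C c * X j ^ 2 : MvPolynomial σ ℂ) := by
  by_cases ha : a = 0
  · have : (C a * X i ^ 2 + C b * X i * X j + C c * X j ^ 2 : MvPolynomial σ ℂ)
        = X j * (C b * X i + C c * X j) := by
      rw [ha, C_0]
      ring
    rw [this]
    exact not_irreducible_mul_of_eval_zero (by simp) (by simp)
  · obtain ⟨s, hs⟩ := IsAlgClosed.exists_pow_nat_eq (b ^ 2 - 4 * a * c) two_pos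
    obtain ⟨r, hr⟩ : ∃ r : ℂ, c = -(r * (a * r + b)) := ⟨(-b + s) / (2 * a), by
      field_simp
      linear_combination hs⟩
    have : (C a * X i ^ 2 + C b * X i * X j + C c * X j ^ 2 : MvPolynomial σ ℂ)
        = (X i - C r * X j) * (C a * X i + C (a * r + b) * X j) := by
      rw [hr]
      simp only [C_neg, C_mul, C_add]
      ring
    rw [this]
    exact not_irreducible_mul_of_eval_zero (by simp) (by simp)

/-- A nonzero complex linear form in three variables has a nonzero real zero. -/
theorem exists_real_zero_of_linear (a : Fin 3 → ℂ) :
    ∃ p : Fin 3 → ℝ, p ≠ 0 ∧ ∑ i, a i * (p i : ℂ) = 0 := by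
  let L : (Fin 3 → ℝ) →ₗ[ℝ] ℂ := Fintype.linearCombination ℝ a
  have hL : LinearMap.ker L ≠ ⊥ := LinearMap.ker_ne_bot_of_finrank_lt (by simp)
  obtain ⟨p, hp, hp0⟩ := Submodule.exists_mem_ne_zero_of_ne_bot hL
  refine ⟨p, hp0, ?_⟩
  rw [LinearMap.mem_ker] at hp
  simpa [L, Fintype.linearCombination_apply, mul_comm] using hp

/-- An irreducible ternary quadratic form over `ℂ` has nonzero gradient at each coordinate
point. -/
theorem exists_eval_pderiv_ne_zero_of_quadratic {g : MvPolynomial (Fin 3) ℂ}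
    (hg : Irreducible g) (h2 : g.IsHomogeneous 2) (k : Fin 3) :
    ∃ i, eval (Pi.single k 1) (pderiv i g) ≠ 0 := by
  obtain ⟨a, rfl⟩ := h2.exists_eq_sum_sum_C_mul_X_mul_X
  by_contra! h
  have hk : ∀ i, a i k + a k i = 0 := fun i => by
    rw [← h i]
    fin_cases k <;> fin_cases i <;> simp [Fin.sum_univ_three, pderiv_X] <;> ring
  have hkk : C (a k k) = (0 : MvPolynomial (Fin 3) ℂ) := by
    rw [add_self_eq_zero.mp (hk k), C_0]
  have hC : ∀ i, C (a i k) + C (a k i) = (0 : MvPolynomial (Fin 3) ℂ) := fun i => by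
    rw [← C_add, hk i, C_0]
  have key : ∀ i j : Fin 3, (∑ i, ∑ j, C (a i j) * X i * X j : MvPolynomial (Fin 3) ℂ)
      ≠ C (a i i) * X i ^ 2 + C (a i j + a j i) * X i * X j + C (a j j) * X j ^ 2 :=
    fun i j he => not_irreducible_binary_quadratic i j _ _ _ (he ▸ hg)
  fin_cases k
  · apply key 1 2
    simp only [Fin.sum_univ_three, C_add, Fin.zero_eta] at hkk hC ⊢
    linear_combination X 0 ^ 2 * hkk + X 0 * X 1 * hC 1 + X 0 * X 2 * hC 2
  · apply key 0 2
    simp only [Fin.sum_univ_three, C_add, Fin.mk_one] at hkk hC ⊢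
    linear_combination X 1 ^ 2 * hkk + X 0 * X 1 * hC 0 + X 1 * X 2 * hC 2
  · apply key 0 1
    simp only [Fin.sum_univ_three, C_add, Fin.reduceFinMk] at hkk hC ⊢
    linear_combination X 2 ^ 2 * hkk + X 0 * X 2 * hC 0 + X 1 * X 2 * hC 1

/-- Every irreducible component of a complex plane cubic through the three coordinate points
has a smooth real point. -/
theorem exists_real_smooth_zero_of_dvd_cubic {f g : MvPolynomial (Fin 3) ℂ}
    {c1 c2 c3 c4 c5 c6 c7 : ℂ}
    (hf : f = C c1 * X 0 ^ 2 * X 1 + C c2 * X 0 ^ 2 * X 2 + C c3 * X 0 * X 1 ^ 2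
      + C c4 * X 0 * X 2 ^ 2 + C c5 * X 1 ^ 2 * X 2 + C c6 * X 1 * X 2 ^ 2
      + C c7 * X 0 * X 1 * X 2)
    (hf0 : f ≠ 0) (hg : Irreducible g) (hdvd : g ∣ f) :
    ∃ p : Fin 3 → ℝ, p ≠ 0 ∧ eval (fun i => (p i : ℂ)) g = 0 ∧
      ∃ i : Fin 3, eval (fun j => (p j : ℂ)) (pderiv i g) ≠ 0 := by
  have of_coordinate : ∀ k : Fin 3, eval (Pi.single k 1) g = 0 →
      (∃ i, eval (Pi.single k 1) (pderiv i g) ≠ 0) →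
      ∃ p : Fin 3 → ℝ, p ≠ 0 ∧ eval (fun i => (p i : ℂ)) g = 0 ∧
        ∃ i : Fin 3, eval (fun j => (p j : ℂ)) (pderiv i g) ≠ 0 := fun k h1 h2 => by
    have hcast : (fun i => ((Pi.single k 1 : Fin 3 → ℝ) i : ℂ)) = Pi.single k 1 := by
      ext i
      by_cases hik : i = k
      · subst hik
        simp
      · simp [hik]
    refine ⟨Pi.single k 1, by simp, ?_⟩
    rw [hcast]
    exact ⟨h1, h2⟩
  have hX : ∀ i : Fin 3, (X i : MvPolynomial (Fin 3) ℂ).IsHomogeneous 1 := isHomogeneous_X ℂ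
  have hfhom : f.IsHomogeneous 3 := by
    rw [hf]
    exact ((((((((hX 0).pow 2).C_mul c1).mul (hX 1)).add
      ((((hX 0).pow 2).C_mul c2).mul (hX 2))).add
      (((hX 0).C_mul c3).mul ((hX 1).pow 2))).add
      (((hX 0).C_mul c4).mul ((hX 2).pow 2))).add
      ((((hX 1).pow 2).C_mul c5).mul (hX 2))).add
      (((hX 1).C_mul c6).mul ((hX 2).pow 2)) |>.add
      ((((hX 0).C_mul c7).mul (hX 1)).mul (hX 2))
  have hf_coord : ∀ k, eval (Pi.single k 1) f = 0 := fun k => by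
    rw [hf]
    fin_cases k <;> simp
  obtain ⟨h, hgh⟩ := hdvd
  have hgh0 : g * h ≠ 0 := hgh ▸ hf0
  have hghhom : (g * h).IsHomogeneous 3 := hgh ▸ hfhom
  obtain ⟨m, hm⟩ := hghhom.of_mul_left hgh0
  obtain ⟨n, hn⟩ := IsHomogeneous.of_mul_left (mul_comm g h ▸ hghhom) (mul_comm g h ▸ hgh0)
  have hmn : m + n = 3 := (hm.mul hn).inj_right hghhom hgh0
  obtain rfl | rfl | rfl | rfl : m = 0 ∨ m = 1 ∨ m = 2 ∨ m = 3 := by omega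
  · have hC := totalDegree_eq_zero_iff_eq_C.mp ((totalDegree_zero_iff_isHomogeneous _).mpr hm)
    refine absurd ?_ hg.not_isUnit
    rw [hC]
    refine (IsUnit.mk0 _ fun h0 => hg.ne_zero ?_).map C
    rw [hC, h0, C_0]
  · obtain ⟨a, rfl⟩ := hm.exists_eq_sum_C_mul_X
    obtain ⟨p, hp0, hp⟩ := exists_real_zero_of_linear a
    refine ⟨p, hp0, by simpa using hp, ?_⟩
    by_contra! hall
    refine hg.ne_zero (Finset.sum_eq_zero fun i _ => ?_)
    have := hall i
    have hai : a i = 0 := by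
      simpa [pderiv_X, Pi.single_apply, apply_ite] using this
    rw [hai, C_0, zero_mul]
  · obtain rfl : n = 1 := by omega
    obtain ⟨b, hb⟩ := hn.exists_eq_sum_C_mul_X
    obtain ⟨k, hk⟩ : ∃ k, b k ≠ 0 := by
      by_contra! hall
      exact right_ne_zero_of_mul hgh0 (by simp [hb, hall])
    refine of_coordinate k ?_ (exists_eval_pderiv_ne_zero_of_quadratic hg hm k)
    have := hf_coord k
    rw [hgh, map_mul] at this
    refine (mul_eq_zero.mp this).resolve_right ?_
    simpa [hb, Pi.single_apply] using hk
  · obtain rfl : n = 0 := by omega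
    have hC := totalDegree_eq_zero_iff_eq_C.mp ((totalDegree_zero_iff_isHomogeneous _).mpr hn)
    have hc : coeff 0 h ≠ 0 := fun h0 => right_ne_zero_of_mul hgh0 (by rw [hC, h0, C_0])
    by_cases hsm : ∃ k, ∃ i, eval (Pi.single k 1) (pderiv i g) ≠ 0
    · obtain ⟨k, hk⟩ := hsm
      refine of_coordinate k ?_ hk
      have := hf_coord k
      rw [hgh, hC, map_mul, eval_C] at this
      exact (mul_eq_zero.mp this).resolve_right hc
    · push Not at hsm
      have hgrad : ∀ k i, eval (Pi.single k 1) (pderiv i f) = 0 := fun k i => by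
        rw [hgh, hC, mul_comm, pderiv_C_mul, map_mul, hsm, mul_zero]
      have e1 : c1 = 0 := by simpa [hf, pderiv_X] using hgrad 0 1
      have e2 : c2 = 0 := by simpa [hf, pderiv_X] using hgrad 0 2
      have e3 : c3 = 0 := by simpa [hf, pderiv_X] using hgrad 1 0
      have e4 : c4 = 0 := by simpa [hf, pderiv_X] using hgrad 2 0
      have e5 : c5 = 0 := by simpa [hf, pderiv_X] using hgrad 1 2
      have e6 : c6 = 0 := by simpa [hf, pderiv_X] using hgrad 2 1
      have hfirr : Irreducible f := by
        rw [hgh, hC]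
        exact (irreducible_mul_isUnit ((IsUnit.mk0 _ hc).map C)).mpr hg
      have hxyz : f = (C c7 * X 0 * X 1) * X 2 := by
        rw [hf, e1, e2, e3, e4, e5, e6]
        simp
      exact absurd (hxyz ▸ hfirr) (not_irreducible_mul_of_eval_zero (by simp) (by simp))

end MvPolynomial

/-- Every irreducible component of a nonzero Spohn cubic contains a smooth point with
real coordinates: every irreducible factor `g` of the complexified Spohn cubic has a
nonzero real zero at which the gradient of `g` does not vanish. -/
theorem spohnCubic_components_have_smooth_real_point
    (a11 a12 a21 a22 b11 b12 b21 b22 : ℝ)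
    (hf : spohnCubic a11 a12 a21 a22 b11 b12 b21 b22 ≠ 0)
    (g : MvPolynomial (Fin 3) ℂ) (hg : Irreducible g)
    (hdvd : g ∣ MvPolynomial.map (algebraMap ℝ ℂ)
      (spohnCubic a11 a12 a21 a22 b11 b12 b21 b22)) :
    ∃ p : Fin 3 → ℝ, p ≠ 0 ∧
      eval (fun i => (p i : ℂ)) g = 0 ∧
      ∃ i : Fin 3, eval (fun j => (p j : ℂ)) (pderiv i g) ≠ 0 := by
  refine exists_real_smooth_zero_of_dvd_cubic
    (c1 := (a11 - a22) * (b11 - b12)) (c2 := (a11 - a21) * (b22 - b11))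
    (c3 := (a12 - a22) * (b11 - b12)) (c4 := (a11 - a21) * (b22 - b21))
    (c5 := (a12 - a22) * (b21 - b12)) (c6 := (a12 - a21) * (b22 - b21))
    (c7 := (a12 - a21) * (b22 - b11) + (a11 - a22) * (b21 - b12)) ?_ ?_ hg hdvd
  · simp [spohnCubic]
  · exact fun h0 => hf (map_injective _ (algebraMap ℝ ℂ).injective (by rw [h0, map_zero]))
end

section
/- Let f be the Spohn cubic of a 2×2 game with real payoff matrices A = (a_{ij}), B = (b_{ij}), and let f_ℂ denote its image in ℂ[x,y,z]. Then the real zeros of f are Zariski dense in its complex zeros: for every polynomial h ∈ ℂ[x,y,z], if h vanishes at every point p ∈ ℝ³ with f(p) = 0, then h vanishes at every point q ∈ ℂ³ with f_ℂ(q) = 0. -/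
open MvPolynomial

/-- A real polynomial is *real dense* if every complex polynomial vanishing at its real zeros
vanishes at its complex zeros. -/
def RealDense {σ : Type*} (F : MvPolynomial σ ℝ) : Prop :=
  ∀ h : MvPolynomial σ ℂ,
    (∀ p : σ → ℝ, eval p F = 0 → eval (fun i => (p i : ℂ)) h = 0) →
      ∀ q : σ → ℂ, eval q (MvPolynomial.map (algebraMap ℝ ℂ) F) = 0 → eval q h = 0

lemma eval_ofReal_map {σ : Type*} (p : σ → ℝ) (F : MvPolynomial σ ℝ) :
    eval (fun i => (p i : ℂ)) (MvPolynomial.map (algebraMap ℝ ℂ) F) = (eval p F : ℝ) := by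
  rw [eval_map]
  exact (eval₂_comp_left (algebraMap ℝ ℂ) (RingHom.id ℝ) p F).symm

lemma RealDense.mul {σ : Type*} {F G : MvPolynomial σ ℝ} (hF : RealDense F) (hG : RealDense G) :
    RealDense (F * G) := by
  intro h hv q hq
  rw [map_mul, map_mul, mul_eq_zero] at hq
  rcases hq with hq | hq
  · exact hF h (fun p hp => hv p (by simp [hp])) q hq
  · exact hG h (fun p hp => hv p (by simp [hp])) q hq

lemma RealDense.rename_equiv {σ τ : Type*} {F : MvPolynomial σ ℝ} (hF : RealDense F)
    (e : σ ≃ τ) : RealDense (rename e F) := by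
  intro h hv q hq
  have key := hF (rename e.symm h) (fun p hp => ?_) (q ∘ e) (by
    rwa [map_rename, eval_rename] at hq)
  · rw [eval_rename] at key
    simpa [Function.comp_assoc] using key
  · rw [eval_rename]
    exact hv (p ∘ e.symm) (by rw [eval_rename]; simpa [Function.comp_assoc] using hp)

lemma realDense_linear (a b c : ℝ) :
    RealDense (C a * X 0 + C b * X 1 + C c * X 2 : MvPolynomial (Fin 3) ℝ) := by
  intro h hv q hq
  let P : Polynomial ℂ :=
    aeval (fun i => Polynomial.C ((q i).re : ℂ) + Polynomial.C ((q i).im : ℂ) * Polynomial.X) h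
  have hP (t : ℂ) : P.eval t = eval (fun i => ((q i).re : ℂ) + (q i).im * t) h := by
    rw [← Polynomial.coe_aeval_eq_eval]
    simp only [P]
    rw [← AlgHom.restrictScalars_apply ℂ, ← AlgHom.comp_apply, comp_aeval]
    simp [aeval_eq_eval]
  have hre := congrArg Complex.re hq
  have him := congrArg Complex.im hq
  simp at hre him
  have hzero : P = 0 := by
    apply Polynomial.eq_zero_of_infinite_isRoot
    refine (Set.infinite_range_of_injective Complex.ofReal_injective).mono ?_
    rintro _ ⟨t, rfl⟩
    have := hv (fun i => (q i).re + (q i).im * t) (by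
      simp
      linear_combination hre + t * him)
    simpa [Polynomial.IsRoot, hP] using this
  have := hP Complex.I
  rw [hzero] at this
  simpa using this.symm

lemma eq_zero_of_eval_ofReal_eq_zero {n : ℕ} (P : MvPolynomial (Fin n) ℂ)
    {U : Set (Fin n → ℝ)} (hU : IsOpen U) (hne : U.Nonempty)
    (hP : ∀ u ∈ U, eval (fun i => (u i : ℂ)) P = 0) : P = 0 := by
  obtain ⟨y, hy⟩ := hne
  obtain ⟨ε, hε, hball⟩ := Metric.isOpen_iff.mp hU y hy
  refine funext_set (fun i => Complex.ofReal '' Metric.ball (y i) ε) (fun i => ?_) fun x hx => ?_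
  · refine Set.Infinite.image Complex.ofReal_injective.injOn ?_
    rw [Real.ball_eq_Ioo]
    exact Set.Ioo_infinite (by linarith)
  · choose u hu hux using fun i => hx i (Set.mem_univ i)
    obtain rfl : (fun i => (u i : ℂ)) = x := funext hux
    rw [map_zero]
    exact hP u (hball (by rwa [ball_pi _ hε, Set.mem_univ_pi]))

/-- The quadratic polynomial `A·x² + B·x + E` in the first variable `x`. -/
noncomputable def quadraticPoly {R : Type*} [CommRing R] {n : ℕ}
    (A B E : MvPolynomial (Fin n) R) : MvPolynomial (Fin (n + 1)) R :=
  rename Fin.succ A * X 0 ^ 2 + rename Fin.succ B * X 0 + rename Fin.succ E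

/-- Pseudo-division by a quadratic polynomial in the first variable. -/
lemma exists_pseudo_division {R : Type*} [CommRing R] {n : ℕ} (A B E : MvPolynomial (Fin n) R)
    (h : MvPolynomial (Fin (n + 1)) R) :
    ∃ (k : ℕ) (q : MvPolynomial (Fin (n + 1)) R) (r s : MvPolynomial (Fin n) R),
      rename Fin.succ A ^ k * h =
        quadraticPoly A B E * q + rename Fin.succ r * X 0 + rename Fin.succ s := by
  induction h using MvPolynomial.induction_on with
  | C a => exact ⟨0, 0, 0, C a, by simp⟩
  | add h₁ h₂ ih₁ ih₂ =>
    obtain ⟨k, q, r, s, h1⟩ := ih₁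
    obtain ⟨l, q', r', s', h2⟩ := ih₂
    refine ⟨k + l, rename Fin.succ A ^ l * q + rename Fin.succ A ^ k * q',
      A ^ l * r + A ^ k * r', A ^ l * s + A ^ k * s', ?_⟩
    simp only [map_add, map_mul, map_pow]
    linear_combination rename Fin.succ A ^ l * h1 + rename Fin.succ A ^ k * h2
  | mul_X h i ih =>
    obtain ⟨k, q, r, s, h1⟩ := ih
    cases i using Fin.cases with
    | zero =>
      refine ⟨k + 1, rename Fin.succ A * q * X 0 + rename Fin.succ r, A * s - r * B, -(r * E), ?_⟩
      simp only [map_sub, map_mul, map_neg, quadraticPoly] at h1 ⊢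
      linear_combination rename Fin.succ A * X 0 * h1
    | succ j =>
      refine ⟨k, q * X j.succ, r * X j, s * X j, ?_⟩
      simp only [map_mul, rename_X]
      linear_combination X j.succ * h1

lemma prime_linear {σ : Type*} {i j : σ} (hij : i ≠ j) {a b : ℂ} (hab : a ≠ 0 ∨ b ≠ 0) :
    Prime (C a * X i + C b * X j : MvPolynomial σ ℂ) := by
  classical
  wlog ha : a ≠ 0 generalizing a b i j
  · rw [add_comm]
    exact this hij.symm hab.symm (hab.resolve_left ha)
  refine (irreducible_mul_X_add (C a) (C b * X j) i (by simpa using ha) (by simp) ?_ ?_).prime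
  · intro hi
    have := vars_mul _ _ hi
    simp [hij] at this
  · exact ((Ne.isUnit ha).map C).isRelPrime_left

lemma eval_rename_succ {R : Type*} [CommRing R] {n : ℕ} (x : R) (u : Fin n → R)
    (r : MvPolynomial (Fin n) R) :
    eval (Fin.cons x u : Fin (n + 1) → R) (rename Fin.succ r) = eval u r := by
  rw [eval_rename]
  rfl

/-- If the discriminant of a quadratic polynomial takes a positive value, then some multiple by a
power of the leading coefficient of any `h` vanishing on the real zeros is divisible by it. -/
lemma dvd_pow_mul_of_discrim_pos {n : ℕ} {A B E : MvPolynomial (Fin n) ℝ} (hA : A ≠ 0)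
    (hd : ∃ u, 0 < discrim (eval u A) (eval u B) (eval u E)) {h : MvPolynomial (Fin (n + 1)) ℂ}
    (hv : ∀ p : Fin (n + 1) → ℝ, eval p (quadraticPoly A B E) = 0 →
      eval (fun i => (p i : ℂ)) h = 0) :
    ∃ k, MvPolynomial.map (algebraMap ℝ ℂ) (quadraticPoly A B E) ∣
      rename Fin.succ (MvPolynomial.map (algebraMap ℝ ℂ) A) ^ k * h := by
  set φ := algebraMap ℝ ℂ
  have hmap : MvPolynomial.map φ (quadraticPoly A B E) =
      quadraticPoly (MvPolynomial.map φ A) (MvPolynomial.map φ B) (MvPolynomial.map φ E) := by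
    simp [quadraticPoly, map_rename]
  obtain ⟨k, q, r, s, hdiv⟩ := exists_pseudo_division (MvPolynomial.map φ A)
    (MvPolynomial.map φ B) (MvPolynomial.map φ E) h
  rw [← hmap] at hdiv
  have hA' : MvPolynomial.map φ A ≠ 0 := by
    rwa [Ne, map_eq_zero_iff _ (map_injective φ φ.injective)]
  have hU : IsOpen {u | 0 < discrim (eval u A) (eval u B) (eval u E)} := by
    refine isOpen_lt continuous_const ?_
    unfold discrim
    have := fun P : MvPolynomial (Fin n) ℝ => MvPolynomial.continuous_eval P
    fun_prop
  have hroot (x : ℝ) (u : Fin n → ℝ)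
      (hx : eval u A * (x * x) + eval u B * x + eval u E = 0) :
      eval (fun i => (u i : ℂ)) r * x + eval (fun i => (u i : ℂ)) s = 0 := by
    have hF : eval (Fin.cons x u : Fin (n + 1) → ℝ) (quadraticPoly A B E) = 0 := by
      simp only [quadraticPoly, map_add, map_mul, map_pow, eval_rename_succ, eval_X,
        Fin.cons_zero]
      linear_combination hx
    have hcons : (fun i => ((Fin.cons x u : Fin (n + 1) → ℝ) i : ℂ)) =
        Fin.cons (x : ℂ) (fun i => (u i : ℂ)) := by
      ext i
      cases i using Fin.cases <;> simp
    have hev := congrArg (eval (fun i => ((Fin.cons x u : Fin (n + 1) → ℝ) i : ℂ))) hdiv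
    simp only [map_mul, map_add, hv _ hF, φ, eval_ofReal_map, hF] at hev
    rw [hcons] at hev
    simpa [eval_rename_succ] using hev.symm
  have hrs (u) (hu : u ∈ {u | 0 < discrim (eval u A) (eval u B) (eval u E)})
      (hAu : eval u A ≠ 0) :
      eval (fun i => (u i : ℂ)) r = 0 ∧ eval (fun i => (u i : ℂ)) s = 0 := by
    have hsq := Real.mul_self_sqrt (le_of_lt hu)
    have hpos := Real.sqrt_pos.mpr hu
    set d := √(discrim (eval u A) (eval u B) (eval u E))
    have h1 := hroot _ u ((quadratic_eq_zero_iff hAu hsq.symm _).mpr (Or.inl rfl))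
    have h2 := hroot _ u ((quadratic_eq_zero_iff hAu hsq.symm _).mpr (Or.inr rfl))
    have hr : eval (fun i => (u i : ℂ)) r = 0 := by
      have hA2 : (eval u A : ℂ) ≠ 0 := by exact_mod_cast hAu
      have hd2 : (d : ℂ) ≠ 0 := by exact_mod_cast hpos.ne'
      push_cast at h1 h2
      have h3 : eval (fun i => (u i : ℂ)) r * ((d : ℂ) / eval u A) = 0 := by
        linear_combination h1 - h2
      exact (mul_eq_zero.mp h3).resolve_right (div_ne_zero hd2 hA2)
    exact ⟨hr, by simpa [hr] using h1⟩
  have hzero (P : MvPolynomial (Fin n) ℂ)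
      (hP : ∀ u, u ∈ {u | 0 < discrim (eval u A) (eval u B) (eval u E)} → eval u A ≠ 0 →
        eval (fun i => (u i : ℂ)) P = 0) : P = 0 := by
    have := eq_zero_of_eval_ofReal_eq_zero (MvPolynomial.map φ A * P) hU hd fun u hu => by
      rw [map_mul, eval_ofReal_map]
      by_cases hAu : eval u A = 0
      · simp [hAu]
      · simp [hP u hu hAu]
    exact (mul_eq_zero.mp this).resolve_left hA'
  rw [hzero r fun u hu hAu => (hrs u hu hAu).1, hzero s fun u hu hAu => (hrs u hu hAu).2] at hdiv
  exact ⟨k, q, by simpa using hdiv⟩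

lemma realDense_quadraticPoly {a b : ℝ} (hab : a ≠ 0 ∨ b ≠ 0) {B E : MvPolynomial (Fin 2) ℝ}
    (hd : ∃ u, 0 < discrim (eval u (C a * X 0 + C b * X 1)) (eval u B) (eval u E)) :
    RealDense (quadraticPoly (C a * X 0 + C b * X 1) B E) := by
  intro h hv q hq
  set φ := algebraMap ℝ ℂ
  set A : MvPolynomial (Fin 2) ℝ := C a * X 0 + C b * X 1
  have hAφ : rename Fin.succ (MvPolynomial.map φ A) =
      (C (a : ℂ) * X 1 + C (b : ℂ) * X 2 : MvPolynomial (Fin 3) ℂ) := by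
    simp [A, φ]
  have hprime : Prime (rename Fin.succ (MvPolynomial.map φ A)) := by
    rw [hAφ]
    exact prime_linear (by decide) (by exact_mod_cast hab)
  have hA : A ≠ 0 := by
    intro h0
    exact hprime.ne_zero (by simp [h0])
  obtain ⟨k, hk⟩ := dvd_pow_mul_of_discrim_pos hA hd hv
  by_cases hqA : eval q (rename Fin.succ (MvPolynomial.map φ A)) = 0
  · by_cases hdvd : rename Fin.succ (MvPolynomial.map φ A) ∣
        MvPolynomial.map φ (quadraticPoly A B E)
    · refine realDense_linear 0 a b h (fun p hp => hv p ?_) q ?_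
      · obtain ⟨G, hG⟩ := hdvd
        have := congrArg (eval (fun i => (p i : ℂ))) hG
        rw [eval_ofReal_map, map_mul, ← map_rename, eval_ofReal_map] at this
        have hpA : eval p (rename Fin.succ A) = 0 := by
          simpa [A] using hp
        simpa [hpA] using this
      · simpa [hAφ] using hqA
    · obtain ⟨G, hG⟩ := hk
      obtain ⟨G', rfl⟩ := hprime.pow_dvd_of_dvd_mul_left k hdvd ⟨h, hG.symm⟩
      have : h = MvPolynomial.map φ (quadraticPoly A B E) * G' := by
        apply mul_left_cancel₀ (pow_ne_zero k hprime.ne_zero)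
        linear_combination hG
      rw [this, map_mul, hq, zero_mul]
  · obtain ⟨G, hG⟩ := hk
    have := congrArg (eval q) hG
    rw [map_mul, map_mul, hq, zero_mul, map_pow] at this
    exact (mul_eq_zero.mp this).resolve_left (pow_ne_zero k hqA)

/-- A ternary cubic passing through the three coordinate points. -/
noncomputable def ternaryCubic (c1 c2 c3 c4 c5 c6 c7 : ℝ) : MvPolynomial (Fin 3) ℝ :=
  C c1 * X 0 ^ 2 * X 1 + C c2 * X 0 ^ 2 * X 2 + C c3 * X 0 * X 1 ^ 2 + C c4 * X 0 * X 2 ^ 2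
    + C c5 * X 1 ^ 2 * X 2 + C c6 * X 1 * X 2 ^ 2 + C c7 * X 0 * X 1 * X 2

section

variable {c1 c2 c3 c4 c5 c6 c7 : ℝ}

lemma RealDense.ternaryCubic_swap_zero_one (h : RealDense (ternaryCubic c3 c5 c1 c6 c2 c4 c7)) :
    RealDense (ternaryCubic c1 c2 c3 c4 c5 c6 c7) := by
  convert h.rename_equiv (Equiv.swap 0 1) using 1
  have h2 : Equiv.swap (0 : Fin 3) 1 2 = 2 := by decide
  simp only [ternaryCubic, map_add, map_mul, map_pow, rename_C, rename_X, h2,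
    Equiv.swap_apply_left, Equiv.swap_apply_right]
  ring

lemma RealDense.ternaryCubic_swap_zero_two (h : RealDense (ternaryCubic c6 c4 c5 c2 c3 c1 c7)) :
    RealDense (ternaryCubic c1 c2 c3 c4 c5 c6 c7) := by
  convert h.rename_equiv (Equiv.swap 0 2) using 1
  have h1 : Equiv.swap (0 : Fin 3) 2 1 = 1 := by decide
  simp only [ternaryCubic, map_add, map_mul, map_pow, rename_C, rename_X, h1,
    Equiv.swap_apply_left, Equiv.swap_apply_right]
  ring

lemma realDense_ternaryCubic_of_quadratic (h : c1 ≠ 0 ∨ c2 ≠ 0)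
    (hd : c3 ≠ 0 ∨ c4 ≠ 0 ∨ (c7 ≠ 0 ∧ c5 = 0 ∧ c6 = 0)) :
    RealDense (ternaryCubic c1 c2 c3 c4 c5 c6 c7) := by
  have key : ternaryCubic c1 c2 c3 c4 c5 c6 c7 = quadraticPoly (C c1 * X 0 + C c2 * X 1)
      (C c3 * X 0 ^ 2 + C c7 * X 0 * X 1 + C c4 * X 1 ^ 2)
      (C c5 * X 0 ^ 2 * X 1 + C c6 * X 0 * X 1 ^ 2) := by
    simp [ternaryCubic, quadraticPoly]
    ring
  rw [key]
  apply realDense_quadraticPoly h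
  by_cases h3 : c3 = 0
  · by_cases h4 : c4 = 0
    · obtain ⟨h7, rfl, rfl⟩ := (hd.resolve_left (not_not.mpr h3)).resolve_left (not_not.mpr h4)
      exact ⟨![1, 1], by simp [discrim, h3, h4]; positivity⟩
    · exact ⟨![0, 1], by simp [discrim]; positivity⟩
  · exact ⟨![1, 0], by simp [discrim]; positivity⟩

lemma realDense_binary_quadratic {u v w : ℝ} (h : 4 * u * v ≤ w ^ 2) :
    RealDense (C u * X 1 ^ 2 + C w * X 1 * X 2 + C v * X 2 ^ 2 : MvPolynomial (Fin 3) ℝ) := by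
  by_cases hu : u = 0
  · convert (realDense_linear 0 0 1).mul (realDense_linear 0 w v) using 1
    simp [hu]
    ring
  · set d := √(w ^ 2 - 4 * u * v)
    have hd : d ^ 2 = w ^ 2 - 4 * u * v := Real.sq_sqrt (by linarith)
    convert (realDense_linear 0 u ((w + d) / 2)).mul
      (realDense_linear 0 1 ((w - d) / (2 * u))) using 1
    have hw : w = u * ((w - d) / (2 * u)) + (w + d) / 2 := by
      field_simp
      ring
    have hv : v = (w + d) / 2 * ((w - d) / (2 * u)) := by
      field_simp
      linear_combination hd
    have hw' := congrArg (C (σ := Fin 3)) hw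
    have hv' := congrArg (C (σ := Fin 3)) hv
    simp only [C_add, C_mul] at hw' hv'
    simp only [C_0, C_1]
    linear_combination hw' * X 1 * X 2 + hv' * X 2 ^ 2

lemma realDense_ternaryCubic_of_linear (h : 4 * c3 * c4 ≤ c7 ^ 2 ∨ c5 ≠ 0 ∨ c6 ≠ 0) :
    RealDense (ternaryCubic 0 0 c3 c4 c5 c6 c7) := by
  by_cases h5 : c5 = 0
  · by_cases h6 : c6 = 0
    · convert (realDense_linear 1 0 0).mul (realDense_binary_quadratic
        ((h.resolve_right (by simp [h5, h6])))) using 1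
      simp [ternaryCubic, h5, h6]
      ring
    · by_cases h3 : c3 = 0
      · by_cases h7 : c7 = 0
        · convert ((realDense_linear 0 0 1).mul (realDense_linear 0 0 1)).mul
            (realDense_linear c4 c6 0) using 1
          simp [ternaryCubic, h3, h5, h7]
          ring
        · exact (realDense_ternaryCubic_of_quadratic (Or.inl h6)
            (Or.inr (Or.inr ⟨h7, h3, rfl⟩))).ternaryCubic_swap_zero_two
      · exact (realDense_ternaryCubic_of_quadratic (Or.inl h3)
            (Or.inr (Or.inl h6))).ternaryCubic_swap_zero_one
  · by_cases h4 : c4 = 0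
    · by_cases h6 : c6 = 0
      · by_cases h7 : c7 = 0
        · convert ((realDense_linear 0 1 0).mul (realDense_linear 0 1 0)).mul
            (realDense_linear c3 0 c5) using 1
          simp [ternaryCubic, h4, h6, h7]
          ring
        · exact (realDense_ternaryCubic_of_quadratic (Or.inr h5)
            (Or.inr (Or.inr ⟨h7, rfl, h4⟩))).ternaryCubic_swap_zero_one
      · exact (realDense_ternaryCubic_of_quadratic (Or.inl h6)
            (Or.inl h5)).ternaryCubic_swap_zero_two
    · exact (realDense_ternaryCubic_of_quadratic (Or.inr h4)
            (Or.inl h5)).ternaryCubic_swap_zero_two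

lemma realDense_ternaryCubic
    (hx : c1 = 0 → c2 = 0 → c5 = 0 → c6 = 0 → 4 * c3 * c4 ≤ c7 ^ 2)
    (hy : c3 = 0 → c5 = 0 → c2 = 0 → c4 = 0 → 4 * c1 * c6 ≤ c7 ^ 2)
    (hz : c6 = 0 → c4 = 0 → c3 = 0 → c1 = 0 → 4 * c5 * c2 ≤ c7 ^ 2) :
    RealDense (ternaryCubic c1 c2 c3 c4 c5 c6 c7) := by
  by_cases h12 : c1 = 0 ∧ c2 = 0
  · obtain ⟨rfl, rfl⟩ := h12
    exact realDense_ternaryCubic_of_linear (by tauto)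
  by_cases h35 : c3 = 0 ∧ c5 = 0
  · obtain ⟨rfl, rfl⟩ := h35
    exact (realDense_ternaryCubic_of_linear (by tauto)).ternaryCubic_swap_zero_one
  by_cases h64 : c6 = 0 ∧ c4 = 0
  · obtain ⟨rfl, rfl⟩ := h64
    exact (realDense_ternaryCubic_of_linear (by tauto)).ternaryCubic_swap_zero_two
  by_cases h34 : c3 ≠ 0 ∨ c4 ≠ 0
  · exact realDense_ternaryCubic_of_quadratic (by tauto) (by tauto)
  · exact (realDense_ternaryCubic_of_quadratic (by tauto) (by tauto)).ternaryCubic_swap_zero_one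

end

/-- The real zeros of the Spohn cubic are Zariski dense in its complex zeros: any
complex polynomial vanishing on all real zeros of the Spohn cubic also vanishes on
all complex zeros of its complexification. -/
theorem spohnCubic_real_points_zariski_dense
    (a11 a12 a21 a22 b11 b12 b21 b22 : ℝ)
    (h : MvPolynomial (Fin 3) ℂ)
    (hvanish : ∀ p : Fin 3 → ℝ,
      eval p (spohnCubic a11 a12 a21 a22 b11 b12 b21 b22) = 0 →
      eval (fun i => (p i : ℂ)) h = 0) :
    ∀ q : Fin 3 → ℂ,
      eval q (MvPolynomial.map (algebraMap ℝ ℂ)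
        (spohnCubic a11 a12 a21 a22 b11 b12 b21 b22)) = 0 →
      eval q h = 0 := by
  refine realDense_ternaryCubic ?_ ?_ ?_ h hvanish
  · intro h1 h2 h5 h6
    by_cases hp : (a12 - a22) * (b11 - b12) * ((a11 - a21) * (b22 - b21)) = 0
    · nlinarith [sq_nonneg ((a12 - a21) * (b22 - b11) + (a11 - a22) * (b21 - b12))]
    simp only [mul_eq_zero, not_or] at hp h1 h2 h5 h6
    obtain rfl := sub_eq_zero.mp (h1.resolve_right hp.1.2)
    obtain rfl := sub_eq_zero.mp (h2.resolve_left hp.2.1)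
    obtain rfl := sub_eq_zero.mp (h5.resolve_left hp.1.1)
    obtain rfl := sub_eq_zero.mp (h6.resolve_right hp.2.2)
    nlinarith [sq_nonneg ((a12 - a11) * (b22 - b21))]
  · intro h3 h5 h2 h4
    by_cases hp : (a11 - a22) * (b11 - b12) * ((a12 - a21) * (b22 - b21)) = 0
    · nlinarith [sq_nonneg ((a12 - a21) * (b22 - b11) + (a11 - a22) * (b21 - b12))]
    simp only [mul_eq_zero, not_or] at hp h3 h4
    obtain rfl := sub_eq_zero.mp (h3.resolve_right hp.1.2)
    obtain rfl := sub_eq_zero.mp (h4.resolve_right hp.2.2)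
    nlinarith [sq_nonneg ((a11 - a12) * (b11 - b12 + (b22 - b21)))]
  · intro h6 h4 h3 h1
    by_cases hp : (a12 - a22) * (b21 - b12) * ((a11 - a21) * (b22 - b11)) = 0
    · nlinarith [sq_nonneg ((a12 - a21) * (b22 - b11) + (a11 - a22) * (b21 - b12))]
    simp only [mul_eq_zero, not_or] at hp h3 h4
    obtain rfl := sub_eq_zero.mp (h3.resolve_left hp.1.1)
    obtain rfl := sub_eq_zero.mp (h4.resolve_left hp.2.1)
    nlinarith [sq_nonneg ((b22 - b11) * (a11 - a21 - (a12 - a22)))]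
end
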